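/- Let δ > 2 be real. There exists a constant C = C(δ) such that for all integers N ≥ 3 and all θ ∈ ℝ, |∑_{k=1}^{N} e^{2iπ((log k)^δ + θk)}| ≤ C N / (log N)^{(δ−1)/2}. -/

import Mathlib

open Finset

/-- The additive character `x ↦ e^{2πix}`. -/
noncomputable def expCircle (x : ℝ) : ℂ := Complex.exp (2 * Real.pi * Complex.I * (x : ℂ))

lemma norm_expCircle (x : ℝ) : ‖expCircle x‖ = 1 := by
  have h : 2 * Real.pi * Complex.I * (x : ℂ) = ((2 * Real.pi * x : ℝ) : ℂ) * Complex.I := by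
    push_cast; ring
  rw [expCircle, h, Complex.norm_exp_ofReal_mul_I]

lemma expCircle_add (x y : ℝ) : expCircle (x + y) = expCircle x * expCircle y := by
  rw [expCircle, expCircle, expCircle, ← Complex.exp_add]
  push_cast; ring_nf

lemma expCircle_sub_int (x : ℝ) (j : ℤ) : expCircle (x - j) = expCircle x := by
  rw [expCircle, expCircle, Complex.exp_eq_exp_iff_exists_int]
  exact ⟨-j, by push_cast; ring⟩

lemma norm_sum_expCircle_le (a : ℕ → ℝ) (s : Finset ℕ) :
    ‖∑ k ∈ s, expCircle (a k)‖ ≤ #s := by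
  refine (norm_sum_le _ _).trans ?_
  simp [norm_expCircle]

lemma expCircle_sub_one_mul {x : ℝ} (hx : Real.sin (Real.pi * x) ≠ 0) :
    (expCircle x - 1) * (-1 / 2 - Complex.I *
      ((Real.cos (Real.pi * x) / (2 * Real.sin (Real.pi * x)) : ℝ) : ℂ)) = 1 := by
  have h : expCircle x = (Complex.cos (Real.pi * x) + Complex.sin (Real.pi * x) * Complex.I) ^ 2 := by
    rw [← Complex.exp_mul_I, ← Complex.exp_nat_mul, expCircle]
    congr 1; push_cast; ring
  have hs : Complex.sin (Real.pi * x) ≠ 0 := by exact_mod_cast hx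
  have h1 := Complex.sin_sq_add_cos_sq (Real.pi * x)
  have hI := Complex.I_sq
  push_cast
  generalize Complex.sin (Real.pi * x) = s at *
  generalize Complex.cos (Real.pi * x) = c at *
  have h' : expCircle x = 1 - 2 * s ^ 2 + 2 * s * c * Complex.I := by
    linear_combination h + s ^ 2 * hI + h1
  rw [h']
  field_simp
  linear_combination 2 * s * h1 - 2 * c ^ 2 * s * hI

lemma two_mul_le_sin_pi_mul {Δ x : ℝ} (hΔ : 0 ≤ Δ) (h1 : Δ ≤ x) (h2 : x ≤ 1 - Δ) :
    2 * Δ ≤ Real.sin (Real.pi * x) := by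
  have hp := Real.pi_pos
  rcases le_total x (1 / 2) with h | h
  · have := Real.mul_le_sin (x := Real.pi * x) (by nlinarith) (by nlinarith)
    have e : 2 / Real.pi * (Real.pi * x) = 2 * x := by field_simp
    linarith
  · have := Real.mul_le_sin (x := Real.pi * (1 - x)) (by nlinarith) (by nlinarith)
    have e : 2 / Real.pi * (Real.pi * (1 - x)) = 2 * (1 - x) := by field_simp
    rw [show Real.pi * (1 - x) = Real.pi - Real.pi * x by ring, Real.sin_pi_sub] at this
    rw [show Real.pi - Real.pi * x = Real.pi * (1 - x) by ring] at this
    linarith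

lemma cos_div_sin_le_of_le {x y : ℝ} (hx : 0 < x) (hxy : x ≤ y) (hy : y < 1) :
    Real.cos (Real.pi * y) / (2 * Real.sin (Real.pi * y)) ≤
      Real.cos (Real.pi * x) / (2 * Real.sin (Real.pi * x)) := by
  have hp := Real.pi_pos
  have hsx : 0 < Real.sin (Real.pi * x) := Real.sin_pos_of_pos_of_lt_pi (by positivity) (by nlinarith)
  have hsy : 0 < Real.sin (Real.pi * y) :=
    Real.sin_pos_of_pos_of_lt_pi (mul_pos hp (by linarith)) (by nlinarith)
  have hd : 0 ≤ Real.sin (Real.pi * y - Real.pi * x) :=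
    Real.sin_nonneg_of_nonneg_of_le_pi (by nlinarith) (by nlinarith)
  rw [Real.sin_sub] at hd
  rw [div_le_div_iff₀ (by positivity) (by positivity)]
  nlinarith

/-- The Kusmin–Landau inequality. -/
lemma kusmin_landau {a : ℕ → ℝ} {M P : ℕ} {Δ : ℝ} (hΔ : 0 < Δ)
    (hanti : ∀ k, M ≤ k → k + 1 < P → a (k + 2) - a (k + 1) ≤ a (k + 1) - a k)
    (hlow : ∀ k, M ≤ k → k < P → Δ ≤ a (k + 1) - a k)
    (hup : ∀ k, M ≤ k → k < P → a (k + 1) - a k ≤ 1 - Δ) :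
    ‖∑ k ∈ Ico M P, expCircle (a k)‖ ≤ 2 / Δ := by
  rcases le_or_gt P M with hPM | hMP
  · rw [Ico_eq_empty_of_le hPM]; simp; positivity
  set c : ℕ → ℝ := fun k => Real.cos (Real.pi * (a (k + 1) - a k)) /
    (2 * Real.sin (Real.pi * (a (k + 1) - a k))) with hc
  set w : ℕ → ℂ := fun k => -1 / 2 - Complex.I * (c k : ℂ) with hw
  have hsin : ∀ k, M ≤ k → k < P → 2 * Δ ≤ Real.sin (Real.pi * (a (k + 1) - a k)) :=
    fun k h1 h2 => two_mul_le_sin_pi_mul hΔ.le (hlow k h1 h2) (hup k h1 h2)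
  have hE : ∀ k, M ≤ k → k < P →
      expCircle (a (k + 1)) * w k - expCircle (a k) * w k = expCircle (a k) := by
    intro k h1 h2
    have h := expCircle_sub_one_mul (x := a (k + 1) - a k) (by linarith [hsin k h1 h2])
    have e : expCircle (a (k + 1)) = expCircle (a k) * expCircle (a (k + 1) - a k) := by
      rw [← expCircle_add]; congr 1; ring
    rw [e]
    linear_combination (expCircle (a k)) * h
  have hcabs : ∀ k, M ≤ k → k < P → |c k| ≤ 1 / (4 * Δ) := by
    intro k h1 h2
    have h := hsin k h1 h2
    rw [hc, abs_div, abs_of_pos (a := 2 * _) (by linarith)]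
    exact div_le_div₀ zero_le_one (Real.abs_cos_le_one _) (by positivity) (by linarith)
  have hwabs : ∀ k, M ≤ k → k < P → ‖w k‖ ≤ 1 / 2 + 1 / (4 * Δ) := by
    intro k h1 h2
    refine (norm_sub_le _ _).trans ?_
    have := hcabs k h1 h2
    simp only [norm_mul, Complex.norm_I, Complex.norm_real, Real.norm_eq_abs, one_mul]
    norm_num at this ⊢
    exact this
  have key : ∀ n, M ≤ n → n < P →
      ‖∑ k ∈ Ico M (n + 1), expCircle (a k) - expCircle (a (n + 1)) * w n‖ ≤
        ‖w M‖ + c n - c M := by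
    intro n hn
    induction n, hn using Nat.le_induction with
    | base =>
      intro h
      have e : ∑ k ∈ Ico M (M + 1), expCircle (a k) - expCircle (a (M + 1)) * w M =
          -(expCircle (a M) * w M) := by
        simp only [Nat.Ico_succ_singleton, sum_singleton]
        linear_combination -hE M le_rfl h
      rw [e, norm_neg, norm_mul, norm_expCircle]
      linarith
    | succ n hn ih =>
      intro h
      have ih := ih (by omega)
      rw [sum_Ico_succ_top (by omega)]
      have e : ∑ k ∈ Ico M (n + 1), expCircle (a k) + expCircle (a (n + 1)) -
          expCircle (a (n + 1 + 1)) * w (n + 1) =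
          (∑ k ∈ Ico M (n + 1), expCircle (a k) - expCircle (a (n + 1)) * w n) +
          expCircle (a (n + 1)) * (w n - w (n + 1)) := by
        linear_combination -hE (n + 1) (by omega) h
      have hcm : c n ≤ c (n + 1) := by
        have h1 := hlow (n + 1) (by omega) h
        have h2 := hup n (by omega) (by omega)
        exact cos_div_sin_le_of_le (by linarith) (hanti n hn h) (by linarith)
      have hwd : ‖w n - w (n + 1)‖ = c (n + 1) - c n := by
        have : w n - w (n + 1) = Complex.I * ((c (n + 1) - c n : ℝ) : ℂ) := by
          simp only [hw]; push_cast; ring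
        rw [this, norm_mul, Complex.norm_I, Complex.norm_real, Real.norm_eq_abs,
          abs_of_nonneg (by linarith), one_mul]
      rw [e]
      refine (norm_add_le _ _).trans ?_
      rw [norm_mul, norm_expCircle, hwd]
      linarith
  obtain ⟨n, rfl⟩ : ∃ n, P = n + 1 := ⟨P - 1, by omega⟩
  have h1 := key n (by omega) (by omega)
  have h2 := hwabs n (by omega) (by omega)
  have h3 := hwabs M le_rfl hMP
  have h4 := abs_le.1 (hcabs n (by omega) (by omega))
  have h5 := abs_le.1 (hcabs M le_rfl hMP)
  have h6 : Δ ≤ 1 / 2 := by linarith [hlow M le_rfl hMP, hup M le_rfl hMP]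
  have h7 : ‖∑ k ∈ Ico M (n + 1), expCircle (a k)‖ ≤
      (‖w M‖ + c n - c M) + ‖w n‖ := by
    have := norm_add_le (∑ k ∈ Ico M (n + 1), expCircle (a k) - expCircle (a (n + 1)) * w n)
      (expCircle (a (n + 1)) * w n)
    rw [sub_add_cancel, norm_mul, norm_expCircle] at this
    linarith
  have h8 : 1 / (4 * Δ) = (1 / 4) * (1 / Δ) := by field_simp
  have h9 : 2 / Δ = 2 * (1 / Δ) := by ring
  have h10 : 2 ≤ 1 / Δ := by rw [le_div_iff₀ hΔ]; linarith
  rw [h8] at h2 h3 h4 h5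
  rw [h9]
  linarith [h4.2, h5.1]

/-- An antitone sequence on `[M, P)` crosses a threshold at most once. -/
lemma exists_threshold_of_antitone {g : ℕ → ℝ} {M P : ℕ} (hMP : M ≤ P)
    (hanti : ∀ k, M ≤ k → k + 1 < P → g (k + 1) ≤ g k) (t : ℝ) :
    ∃ p, M ≤ p ∧ p ≤ P ∧ (∀ k, M ≤ k → k < p → t ≤ g k) ∧ ∀ k, p ≤ k → k < P → g k < t := by
  induction P, hMP using Nat.le_induction with
  | base => exact ⟨M, le_rfl, le_rfl, fun k _ _ => by omega, fun k _ _ => by omega⟩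
  | succ P hMP ih =>
    obtain ⟨p, h1, h2, h3, h4⟩ := ih fun k hk hk' => hanti k hk (by omega)
    rcases h2.lt_or_eq with h | rfl
    · refine ⟨p, h1, by omega, h3, fun k hk hk' => ?_⟩
      rcases Nat.lt_succ_iff_lt_or_eq.1 hk' with h' | rfl
      · exact h4 k hk h'
      · obtain ⟨m, rfl⟩ : ∃ m, k = m + 1 := ⟨k - 1, by omega⟩
        exact (hanti m (by omega) (by omega)).trans_lt (h4 m (by omega) (by omega))
    · by_cases hp : t ≤ g p
      · refine ⟨p + 1, by omega, le_rfl, fun k hk hk' => ?_, fun k _ _ => by omega⟩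
        rcases Nat.lt_succ_iff_lt_or_eq.1 hk' with h' | rfl
        · exact h3 k hk h'
        · exact hp
      · refine ⟨p, by omega, by omega, h3, fun k hk hk' => ?_⟩
        obtain rfl : k = p := by omega
        exact not_le.1 hp

/-- A discrete van der Corput second-derivative test, for sequences whose first difference varies
by at most `1 / 4`. -/
lemma norm_sum_expCircle_le_of_second_difference {a : ℕ → ℝ} {M P : ℕ} {Δ : ℝ} (hMP : M ≤ P)
    (hΔ : 0 < Δ) (hΔ' : Δ ≤ 1 / 4)
    (hsec : ∀ k, M ≤ k → k + 1 < P → a (k + 2) - a (k + 1) + Δ ^ 2 ≤ a (k + 1) - a k)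
    (hvar : ∀ k l, M ≤ k → k < P → M ≤ l → l < P →
      a (k + 1) - a k - (a (l + 1) - a l) ≤ 1 / 4) :
    ‖∑ k ∈ Ico M P, expCircle (a k)‖ ≤ 7 / Δ := by
  rcases hMP.eq_or_lt with rfl | hlt
  · simp; positivity
  obtain ⟨n, rfl⟩ : ∃ n, P = n + 1 := ⟨P - 1, by omega⟩
  set j : ℤ := round (a (n + 1) - a n)
  have hj := abs_le.1 (abs_sub_round (a (n + 1) - a n))
  set b : ℕ → ℝ := fun k => a k - j * k with hb
  have hbd : ∀ k, b (k + 1) - b k = a (k + 1) - a k - j := by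
    intro k; simp only [hb]; push_cast; ring
  have hsum : ∀ s : Finset ℕ, ∑ k ∈ s, expCircle (a k) = ∑ k ∈ s, expCircle (b k) := by
    intro s
    refine sum_congr rfl fun k _ => ?_
    have := expCircle_sub_int (a k) (j * k)
    push_cast at this
    exact this.symm
  have hsecb : ∀ k, M ≤ k → k + 1 < n + 1 →
      b (k + 2) - b (k + 1) + Δ ^ 2 ≤ b (k + 1) - b k := by
    intro k h1 h2
    have := hsec k h1 h2
    have e := hbd (k + 1)
    rw [show k + 1 + 1 = k + 2 from rfl] at e
    rw [e, hbd k]; linarith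
  have hanti : ∀ k, M ≤ k → k + 1 < n + 1 → b (k + 2) - b (k + 1) ≤ b (k + 1) - b k := by
    intro k h1 h2
    nlinarith [hsecb k h1 h2]
  have hupb : ∀ k, M ≤ k → k < n + 1 → b (k + 1) - b k ≤ 3 / 4 := by
    intro k h1 h2
    rw [hbd]
    linarith [hvar k n h1 h2 (by omega) (by omega), hj.2]
  have hiter : ∀ d k, M ≤ k → k + d < n + 1 →
      d * Δ ^ 2 ≤ b (k + 1) - b k - (b (k + d + 1) - b (k + d)) := by
    intro d k hk
    induction d with
    | zero => intro _; simp
    | succ d ih =>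
      intro h
      have h1 := ih (by omega)
      have h2 := hsecb (k + d) (by omega) (by omega)
      have e1 : k + (d + 1) + 1 = k + d + 2 := by omega
      have e2 : k + (d + 1) = k + d + 1 := by omega
      rw [e1, e2]; push_cast; linarith
  have hlowb : ∀ k, M ≤ k → k < n + 1 → -(1 / 2) ≤ b (k + 1) - b k := by
    intro k h1 h2
    have h := hiter (n - k) k h1 (by omega)
    rw [show k + (n - k) = n by omega, hbd n] at h
    have : 0 ≤ ((n - k : ℕ) : ℝ) * Δ ^ 2 := by positivity
    have h3 : -(1 / 2) ≤ a (n + 1) - a n - (j : ℝ) := hj.1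
    linarith
  obtain ⟨p, hp1, hp2, hp3, hp4⟩ := exists_threshold_of_antitone
    (g := fun k => b (k + 1) - b k) hMP hanti Δ
  obtain ⟨q, hq1, hq2, hq3, hq4⟩ := exists_threshold_of_antitone
    (g := fun k => b (k + 1) - b k) hp2 (fun k h1 h2 => hanti k (by omega) h2) (-Δ)
  have hI : ‖∑ k ∈ Ico M p, expCircle (b k)‖ ≤ 2 / Δ :=
    kusmin_landau hΔ (fun k h1 h2 => hanti k h1 (by omega)) hp3
      (fun k h1 h2 => by linarith [hupb k h1 (by omega)])
  have hIII : ‖∑ k ∈ Ico q (n + 1), expCircle (b k)‖ ≤ 2 / Δ := by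
    have h := kusmin_landau (a := fun k => b k - ((-1 : ℤ) : ℝ) * k) (M := q) (P := n + 1) hΔ
      (fun k h1 h2 => by have := hanti k (by omega) h2; push_cast; linarith)
      (fun k h1 h2 => by have := hlowb k (by omega) h2; push_cast; linarith)
      (fun k h1 h2 => by have := hq4 k h1 h2; push_cast; linarith)
    have e : ∀ k : ℕ, expCircle (b k - ((-1 : ℤ) : ℝ) * k) = expCircle (b k) := by
      intro k
      have := expCircle_sub_int (b k) (-1 * k)
      push_cast at this ⊢
      exact this
    simpa only [e] using h
  have hII : ‖∑ k ∈ Ico p q, expCircle (b k)‖ ≤ 3 / Δ := by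
    refine (norm_sum_expCircle_le b _).trans ?_
    rw [Nat.card_Ico]
    rcases hq1.eq_or_lt with rfl | hpq
    · simp; positivity
    obtain ⟨d, rfl⟩ : ∃ d, q = p + d + 1 := ⟨q - p - 1, by omega⟩
    have h1 := hiter d p hp1 (by omega)
    have h2 := hp4 p le_rfl (by omega)
    have h3 := hq3 (p + d) (by omega) (by omega)
    have h4 : (d : ℝ) * Δ ^ 2 ≤ 2 * Δ := by linarith
    have h5 : (d : ℝ) * Δ ≤ 2 := by nlinarith
    rw [show p + d + 1 - p = d + 1 by omega, le_div_iff₀ hΔ]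
    push_cast; linarith
  rw [hsum, ← sum_Ico_consecutive _ hp1 hp2, ← sum_Ico_consecutive _ hq1 hq2]
  refine (norm_add_le _ _).trans ?_
  have := norm_add_le (∑ k ∈ Ico p q, expCircle (b k)) (∑ k ∈ Ico q (n + 1), expCircle (b k))
  have e : 7 / Δ = 2 / Δ + (3 / Δ + 2 / Δ) := by ring
  rw [e]; linarith

lemma hasDerivAt_log_rpow (p : ℝ) {x : ℝ} (hx : 1 < x) :
    HasDerivAt (fun y => Real.log y ^ p) (p * Real.log x ^ (p - 1) / x) x := by
  have h := (Real.hasDerivAt_log (by linarith : x ≠ 0)).rpow_const (p := p)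
    (Or.inl (Real.log_pos hx).ne')
  convert h using 1
  ring

lemma hasDerivAt_deriv_log_rpow (p : ℝ) {x : ℝ} (hx : 1 < x) :
    HasDerivAt (fun y => p * Real.log y ^ (p - 1) / y)
      (p * Real.log x ^ (p - 2) * (p - 1 - Real.log x) / x ^ 2) x := by
  have hx0 : x ≠ 0 := by linarith
  have h := ((hasDerivAt_log_rpow (p - 1) hx).const_mul p).div (hasDerivAt_id x) hx0
  refine h.congr_deriv ?_
  have e : Real.log x ^ (p - 1) = Real.log x ^ (p - 2) * Real.log x := by
    rw [← Real.rpow_add_one (Real.log_pos hx).ne']; congr 1; ring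
  rw [show p - 1 - 1 = p - 2 by ring, e]
  simp only [id]
  field_simp

lemma exists_log_rpow_sub_eq (p : ℝ) {x : ℝ} (hx : 1 < x) :
    ∃ y, x < y ∧ y < x + 1 ∧
      Real.log (x + 1) ^ p - Real.log x ^ p = p * Real.log y ^ (p - 1) / y := by
  obtain ⟨y, hy, h⟩ := exists_hasDerivAt_eq_slope (fun y => Real.log y ^ p)
    (fun y => p * Real.log y ^ (p - 1) / y) (lt_add_one x)
    (fun y hy => (hasDerivAt_log_rpow p (hx.trans_le hy.1)).continuousAt.continuousWithinAt)
    (fun y hy => hasDerivAt_log_rpow p (hx.trans hy.1))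
  exact ⟨y, hy.1, hy.2, by rw [h]; ring⟩

lemma exists_log_rpow_second_difference_eq (p : ℝ) {x : ℝ} (hx : 1 < x) :
    ∃ y, x < y ∧ y < x + 2 ∧
      Real.log (x + 2) ^ p - Real.log (x + 1) ^ p - (Real.log (x + 1) ^ p - Real.log x ^ p) =
        p * Real.log y ^ (p - 2) * (p - 1 - Real.log y) / y ^ 2 := by
  have hd : ∀ y, 1 < y → HasDerivAt (fun y => Real.log (y + 1) ^ p - Real.log y ^ p)
      (p * Real.log (y + 1) ^ (p - 1) / (y + 1) - p * Real.log y ^ (p - 1) / y) y := fun y hy =>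
    ((hasDerivAt_log_rpow p (by linarith : 1 < y + 1)).comp_add_const y 1).sub
      (hasDerivAt_log_rpow p hy)
  obtain ⟨y, hy, h⟩ := exists_hasDerivAt_eq_slope _ _ (lt_add_one x)
    (fun y hy => (hd y (hx.trans_le hy.1)).continuousAt.continuousWithinAt)
    (fun y hy => hd y (hx.trans hy.1))
  have hy1 : 1 < y := hx.trans hy.1
  obtain ⟨z, hz, h'⟩ := exists_hasDerivAt_eq_slope _ _ (lt_add_one y)
    (fun z hz => (hasDerivAt_deriv_log_rpow p
      (hy1.trans_le hz.1)).continuousAt.continuousWithinAt)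
    (fun z hz => hasDerivAt_deriv_log_rpow p (hy1.trans hz.1))
  refine ⟨z, hy.1.trans hz.1, by linarith [hz.2, hy.2], ?_⟩
  rw [h']
  simp only [add_sub_cancel_left, div_one] at h ⊢
  rw [h, show x + 1 + 1 = x + 2 by ring]

lemma log_rpow_second_difference_le {p x X : ℝ} (hp : 2 < p) (hX : 2 ≤ X)
    (hlog : 4 * (p - 1) ≤ Real.log X) (hx : √X ≤ x) (hxX : x + 2 ≤ 2 * X) :
    Real.log (x + 2) ^ p - Real.log (x + 1) ^ p + p / 8 * (1 / 2) ^ (p - 1) *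
      Real.log X ^ (p - 1) / X ^ 2 ≤ Real.log (x + 1) ^ p - Real.log x ^ p := by
  have hs : 1 < √X := by rw [Real.lt_sqrt] <;> linarith
  obtain ⟨y, hxy, hyx, h⟩ := exists_log_rpow_second_difference_eq p (hs.trans_le hx)
  have hy0 : 0 < y := by linarith
  have hly : Real.log X / 2 ≤ Real.log y := by
    rw [← Real.log_sqrt (by linarith)]
    exact Real.log_le_log (by linarith) (by linarith)
  have hlX : 0 < Real.log X := Real.log_pos (by linarith)
  have e : Real.log y ^ (p - 1) = Real.log y ^ (p - 2) * Real.log y := by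
    rw [← Real.rpow_add_one (by linarith)]; congr 1; ring
  have hpow : (1 / 2) ^ (p - 1) * Real.log X ^ (p - 1) ≤ Real.log y ^ (p - 1) := by
    rw [← Real.mul_rpow (by norm_num) hlX.le]
    exact Real.rpow_le_rpow (by positivity) (by linarith) (by linarith)
  have h1 : p / 8 * (1 / 2) ^ (p - 1) * Real.log X ^ (p - 1) / X ^ 2 ≤
      p / 2 * Real.log y ^ (p - 1) / y ^ 2 := by
    rw [div_le_div_iff₀ (by positivity) (by positivity)]
    have hy2 : y ^ 2 ≤ 4 * X ^ 2 := by nlinarith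
    have h0 : 0 ≤ (1 / 2 : ℝ) ^ (p - 1) * Real.log X ^ (p - 1) := by positivity
    have h0' := h0.trans hpow
    calc p / 8 * (1 / 2) ^ (p - 1) * Real.log X ^ (p - 1) * y ^ 2
        = p / 8 * (((1 / 2) ^ (p - 1) * Real.log X ^ (p - 1)) * y ^ 2) := by ring
      _ ≤ p / 8 * (Real.log y ^ (p - 1) * (4 * X ^ 2)) := by gcongr
      _ = _ := by ring
  have h2 : p * Real.log y ^ (p - 2) * (p - 1 - Real.log y) / y ^ 2 ≤
      -(p / 2 * Real.log y ^ (p - 1) / y ^ 2) := by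
    rw [← neg_div, e]
    gcongr
    have h0 : 0 ≤ p * Real.log y ^ (p - 2) :=
      mul_nonneg (by linarith) (Real.rpow_nonneg (by linarith) _)
    nlinarith
  linarith

lemma log_rpow_difference_mem {p x X : ℝ} (hp : 2 < p) (hX : 2 ≤ X) (hx : √X ≤ x)
    (hxX : x + 1 ≤ 2 * X) :
    0 ≤ Real.log (x + 1) ^ p - Real.log x ^ p ∧ Real.log (x + 1) ^ p - Real.log x ^ p ≤
      p * 2 ^ (p - 1) * Real.log X ^ (p - 1) / √X := by
  have hs : 1 < √X := by rw [Real.lt_sqrt] <;> linarith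
  obtain ⟨y, hxy, hyx, h⟩ := exists_log_rpow_sub_eq p (hs.trans_le hx)
  have hly : 0 ≤ Real.log y := Real.log_nonneg (by linarith)
  have hy0 : 0 < y := by linarith
  have hly2 : Real.log y ≤ 2 * Real.log X := by
    have h1 : Real.log (X ^ 2) = 2 * Real.log X := by rw [Real.log_pow]; norm_num
    rw [← h1]
    exact Real.log_le_log hy0 (by nlinarith)
  rw [h]
  refine ⟨by positivity, ?_⟩
  rw [mul_assoc, ← Real.mul_rpow (by norm_num) (Real.log_nonneg (by linarith))]
  have h0 : 0 ≤ p * (2 * Real.log X) ^ (p - 1) :=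
    mul_nonneg (by linarith) (Real.rpow_nonneg (hly.trans hly2) _)
  have : √X ≤ y := by linarith
  gcongr
  linarith

lemma eventually_log_rpow_le (s : ℝ) {ε : ℝ} (hε : 0 < ε) :
    ∀ᶠ N : ℕ in Filter.atTop, Real.log N ^ s ≤ ε * √(N : ℝ) := by
  have h := (isLittleO_log_rpow_rpow_atTop s (by norm_num : (0 : ℝ) < 1 / 2)).bound hε
  filter_upwards [tendsto_natCast_atTop_atTop.eventually h] with N hN
  rw [← Real.sqrt_eq_rpow, Real.norm_of_nonneg (Real.sqrt_nonneg _)] at hN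
  exact (le_abs_self _).trans hN

lemma eventually_norm_sum_expCircle_log_rpow_le {δ : ℝ} (hδ : 2 < δ) :
    ∃ C, ∀ᶠ N : ℕ in Filter.atTop, ∀ θ : ℝ,
      ‖∑ k ∈ Icc 1 N, expCircle (Real.log k ^ δ + θ * k)‖ ≤
        C * (N : ℝ) / Real.log N ^ ((δ - 1) / 2) := by
  set c : ℝ := √(δ / 8 * (1 / 2) ^ (δ - 1)) with hc
  have hc0 : 0 < c := Real.sqrt_pos.2 (by positivity)
  have hc2 : c ^ 2 = δ / 8 * (1 / 2) ^ (δ - 1) := Real.sq_sqrt (by positivity)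
  refine ⟨1 + 7 / c, ?_⟩
  have hlogN : ∀ᶠ N : ℕ in Filter.atTop, 4 * (δ - 1) ≤ Real.log N :=
    (Real.tendsto_log_atTop.comp tendsto_natCast_atTop_atTop).eventually_ge_atTop _
  filter_upwards [hlogN, Filter.eventually_ge_atTop 3,
    eventually_log_rpow_le ((δ - 1) / 2) one_pos,
    eventually_log_rpow_le ((δ - 1) / 2) (ε := 1 / (4 * c)) (by positivity),
    eventually_log_rpow_le (δ - 1) (ε := 1 / (4 * (δ * 2 ^ (δ - 1)))) (by positivity)]
    with N hN1 hN2 hN3 hN4 hN5 θ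
  have hX : (3 : ℝ) ≤ N := by exact_mod_cast hN2
  have hl : 0 < Real.log N := Real.log_pos (by linarith)
  have hsq : √(N : ℝ) * √(N : ℝ) = N := Real.mul_self_sqrt (by linarith)
  have hs0 : 0 < √(N : ℝ) := Real.sqrt_pos.2 (by linarith)
  have hs1 : √(N : ℝ) ≤ N := by nlinarith
  set M := Nat.sqrt N + 1 with hM
  have hMN : M ≤ N + 1 := by have := Nat.sqrt_le_self N; omega
  have hkM : ∀ k : ℕ, M ≤ k → √(N : ℝ) ≤ k := fun k hk =>
    Real.real_sqrt_le_nat_sqrt_succ.trans (by exact_mod_cast hk)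
  set Λ := Real.log N ^ ((δ - 1) / 2) with hΛ
  have hΛ0 : 0 < Λ := by positivity
  have hΛ2 : Λ ^ 2 = Real.log N ^ (δ - 1) := by
    rw [hΛ, ← Real.rpow_natCast, ← Real.rpow_mul hl.le]; congr 1; push_cast; ring
  have hmain : ‖∑ k ∈ Ico M (N + 1), expCircle (Real.log k ^ δ + θ * k)‖ ≤ 7 / (c * Λ / N) := by
    refine norm_sum_expCircle_le_of_second_difference hMN (by positivity) ?_ ?_ ?_
    · rw [div_le_iff₀ (by linarith)]
      calc c * Λ ≤ c * (1 / (4 * c) * √(N : ℝ)) := by gcongr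
        _ = 1 / 4 * √(N : ℝ) := by field_simp
        _ ≤ 1 / 4 * N := by gcongr
    · intro k hk hkN
      have hkN' : (k : ℝ) + 1 ≤ N := by exact_mod_cast (by omega : k + 1 ≤ N)
      have h := log_rpow_second_difference_le hδ (by linarith) hN1 (hkM k hk)
        (by linarith)
      rw [div_pow, mul_pow, hc2, hΛ2]
      push_cast
      linarith
    · intro k m hk hkN hm hmN
      have hkN' : (k : ℝ) ≤ N := by exact_mod_cast (by omega : k ≤ N)
      have hmN' : (m : ℝ) ≤ N := by exact_mod_cast (by omega : m ≤ N)
      have h1 := log_rpow_difference_mem hδ (by linarith) (hkM k hk) (by linarith)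
      have h2 := log_rpow_difference_mem hδ (by linarith) (hkM m hm) (by linarith)
      have h3 : δ * 2 ^ (δ - 1) * Real.log N ^ (δ - 1) / √(N : ℝ) ≤ 1 / 4 := by
        rw [div_le_iff₀ hs0]
        calc δ * 2 ^ (δ - 1) * Real.log N ^ (δ - 1)
            ≤ δ * 2 ^ (δ - 1) * (1 / (4 * (δ * 2 ^ (δ - 1))) * √(N : ℝ)) := by gcongr
          _ = 1 / 4 * √(N : ℝ) := by field_simp
      push_cast
      linarith [h1.2, h2.1]
  have hinit : ‖∑ k ∈ Ico 1 M, expCircle (Real.log k ^ δ + θ * k)‖ ≤ N / Λ := by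
    refine (norm_sum_expCircle_le _ _).trans ?_
    rw [Nat.card_Ico, hM, Nat.add_sub_cancel, le_div_iff₀ hΛ0, ← hsq]
    have : (Nat.sqrt N : ℝ) ≤ √(N : ℝ) := Real.nat_sqrt_le_real_sqrt
    rw [one_mul] at hN3
    gcongr
  rw [← Finset.Ico_add_one_right_eq_Icc, ← sum_Ico_consecutive _ (by omega : 1 ≤ M) hMN]
  refine (norm_add_le _ _).trans ((add_le_add hinit hmain).trans_eq ?_)
  field_simp

/-- For `δ > 2`, `|∑_{k=1}^N e^{2iπ((log k)^δ + θk)}| ≤ C N/(log N)^{(δ−1)/2}`. -/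
theorem stmt_19 (δ : ℝ) (hδ : 2 < δ) :
    ∃ C > 0, ∀ N : ℕ, 3 ≤ N → ∀ θ : ℝ,
      ‖∑ k ∈ Finset.Icc 1 N,
          Complex.exp (2 * Real.pi * Complex.I * ((Real.log k ^ δ + θ * k : ℝ) : ℂ))‖
        ≤ C * (N : ℝ) / Real.log N ^ ((δ - 1) / 2) := by
  obtain ⟨C, hC⟩ := eventually_norm_sum_expCircle_log_rpow_le hδ
  obtain ⟨N₀, hN₀⟩ := Filter.eventually_atTop.1 hC
  refine ⟨max 1 (max C (Real.log N₀ ^ ((δ - 1) / 2))), by positivity, fun N hN θ => ?_⟩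
  have hX : (3 : ℝ) ≤ N := by exact_mod_cast hN
  have hl : 0 < Real.log N := Real.log_pos (by linarith)
  change ‖∑ k ∈ Icc 1 N, expCircle (Real.log k ^ δ + θ * k)‖ ≤ _
  rcases le_total N₀ N with h | h
  · refine (hN₀ N h θ).trans ?_
    gcongr
    exact (le_max_left _ _).trans (le_max_right _ _)
  · refine (norm_sum_expCircle_le _ _).trans ?_
    rw [Nat.card_Icc, Nat.add_sub_cancel, le_div_iff₀ (by positivity), mul_comm]
    gcongr
    refine le_trans ?_ ((le_max_right _ _).trans (le_max_right _ _))
    gcongr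
    linarith
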